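/- arXiv:2605.14848 — 5 statements merged into one kernel-verified Lean document; each statement's English description precedes it below -/
import Mathlib

section
/- Let m ≥ 1 be an integer and let f, g : F₃^m → F₃ be such that every F in the set {f, g, f+g, f−g} satisfies: F is not the zero function, F(0) = 0, and for every w ∈ F₃^m the function F is not equal to the linear function x ↦ w·x. Then the map sending (u, r, v) ∈ F₃ × F₃ × F₃^m to the codeword c(u,r,v) = (u·f(x) + r·g(x) + v·x)_{x ∈ F₃^m∖{0}} is injective; in particular the ternary linear code C_{f,g} = {c(u,r,v) : u, r ∈ F₃, v ∈ F₃^m} has exactly 3^{m+2} codewords, i.e. dimension m + 2. -/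
open Finset

/-- `ζ₃ = e^{2πi/3}`, a primitive complex cube root of unity. -/
noncomputable def zeta3 : ℂ := Complex.exp (2 * Real.pi * Complex.I / 3)

/-- `ζ₃^a` for `a ∈ F₃`. -/
noncomputable def chi (a : ZMod 3) : ℂ := zeta3 ^ a.val

/-- Standard inner product on `F₃^m`. -/
def dotp {m : ℕ} (w x : Fin m → ZMod 3) : ZMod 3 := ∑ i, w i * x i

/-- Walsh transform of `F : F₃^m → F₃`. -/
noncomputable def walsh {m : ℕ} (F : (Fin m → ZMod 3) → ZMod 3)
    (w : Fin m → ZMod 3) : ℂ :=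
  ∑ x : Fin m → ZMod 3, chi (F x - dotp w x)

/-- Ternary Krawtchouk polynomial `K_t(x,m)`. -/
def Kraw (t x m : ℕ) : ℤ :=
  ∑ j ∈ Finset.range (t + 1),
    (-1 : ℤ) ^ j * 2 ^ (t - j) * (x.choose j : ℤ) * ((m - x).choose (t - j) : ℤ)

/-- Lloyd polynomial `Ψ_k(x,m) = Σ_{t=0}^k K_t(x,m)`. -/
def Lloyd (k x m : ℕ) : ℤ := ∑ t ∈ Finset.range (k + 1), Kraw t x m

/-- `f(x) = 1` iff `x ∈ A ∪ C ∪ D`, i.e. `1 ≤ wt(x) ≤ k₂` and `wt(x) ≠ k₁`. -/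
def ffun (m k₁ k₂ : ℕ) (x : Fin m → ZMod 3) : ZMod 3 :=
  if 1 ≤ hammingNorm x ∧ hammingNorm x ≤ k₂ ∧ hammingNorm x ≠ k₁ then 1 else 0

/-- `g(x) = 1` on `B ∪ C` (i.e. `k₁ ≤ wt(x) ≤ k₂ - 1`), `g(x) = -1` on `D` (`wt(x) = k₂`). -/
def gfun (m k₁ k₂ : ℕ) (x : Fin m → ZMod 3) : ZMod 3 :=
  if k₁ ≤ hammingNorm x ∧ hammingNorm x ≤ k₂ - 1 then 1
  else if hammingNorm x = k₂ then -1 else 0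

/-- The codeword `c(u,r,v)` of `C_{f,g}` for the specific `f = ffun`, `g = gfun`. -/
def cw (m k₁ k₂ : ℕ) (u r : ZMod 3) (v : Fin m → ZMod 3) :
    {x : Fin m → ZMod 3 // x ≠ 0} → ZMod 3 :=
  fun x => u * ffun m k₁ k₂ x.1 + r * gfun m k₁ k₂ x.1 + dotp v x.1

/-- Hamming weight of the codeword `c(u,r,v)`. -/
def cwt (m k₁ k₂ : ℕ) (u r : ZMod 3) (v : Fin m → ZMod 3) : ℕ :=
  (Finset.univ.filter
    (fun x : {x : Fin m → ZMod 3 // x ≠ 0} => cw m k₁ k₂ u r v x ≠ 0)).card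

theorem dotp_sub {m : ℕ} (v w x : Fin m → ZMod 3) : dotp (v - w) x = dotp v x - dotp w x := by
  simp [dotp, sub_mul, Finset.sum_sub_distrib]

theorem dotp_smul {m : ℕ} (c : ZMod 3) (w x : Fin m → ZMod 3) :
    dotp (c • w) x = c * dotp w x := by
  simp [dotp, Finset.mul_sum, mul_assoc]

theorem dotp_zero_right {m : ℕ} (w : Fin m → ZMod 3) : dotp w 0 = 0 := by
  simp [dotp]

theorem dotp_single {m : ℕ} (w : Fin m → ZMod 3) (i : Fin m) : dotp w (Pi.single i 1) = w i := by
  simp [dotp, Pi.single_apply]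

theorem eq_zero_of_dotp_eq_zero {m : ℕ} {w : Fin m → ZMod 3} (h : ∀ x, dotp w x = 0) :
    w = 0 :=
  funext fun i => (dotp_single w i).symm.trans (h _)

/-- If a linear combination of `f`, `g` and a linear function vanishes, while no function among
`f`, `g`, `f + g`, `f - g` is linear, then the combination is trivial. -/
theorem eq_zero_of_combination_eq_zero {m : ℕ} {f g : (Fin m → ZMod 3) → ZMod 3}
    (hF : ∀ F ∈ ({f, g, f + g, f - g} : Set ((Fin m → ZMod 3) → ZMod 3)),
      ∀ w : Fin m → ZMod 3, F ≠ fun x => dotp w x)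
    {a b : ZMod 3} {z : Fin m → ZMod 3} (h : ∀ x, a * f x + b * g x + dotp z x = 0) :
    a = 0 ∧ b = 0 ∧ z = 0 := by
  have cases : ∀ a b : ZMod 3, (a = 0 ∧ b = 0) ∨ (a ≠ 0 ∧ b = 0) ∨ (a = 0 ∧ b ≠ 0) ∨
      (a ≠ 0 ∧ b = a) ∨ (a ≠ 0 ∧ b = -a) := by
    decide
  have : Fact (Nat.Prime 3) := ⟨Nat.prime_three⟩
  have not_multiple : ∀ F ∈ ({f, g, f + g, f - g} : Set ((Fin m → ZMod 3) → ZMod 3)),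
      ∀ c : ZMod 3, c ≠ 0 → ¬ ∀ x, c * F x + dotp z x = 0 := by
    intro F hmem c hc hcF
    refine hF F hmem ((-c⁻¹) • z) (funext fun x => ?_)
    rw [dotp_smul, eq_neg_of_add_eq_zero_right (hcF x)]
    field_simp
  rcases cases a b with ⟨rfl, rfl⟩ | ⟨ha, rfl⟩ | ⟨rfl, hb⟩ | ⟨ha, rfl⟩ | ⟨ha, rfl⟩
  · exact ⟨rfl, rfl, eq_zero_of_dotp_eq_zero fun x => by simpa using h x⟩
  · exact absurd (fun x => by simpa using h x) (not_multiple f (by simp) a ha)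
  · exact absurd (fun x => by simpa using h x) (not_multiple g (by simp) b hb)
  · refine absurd (fun x => ?_) (not_multiple (f + g) (by simp) _ ha)
    rw [Pi.add_apply, mul_add]
    exact h x
  · refine absurd (fun x => ?_) (not_multiple (f - g) (by simp) a ha)
    rw [Pi.sub_apply, ← h x]
    ring

theorem stmt1 (m : ℕ) (hm : 1 ≤ m) (f g : (Fin m → ZMod 3) → ZMod 3)
    (hF : ∀ F ∈ ({f, g, f + g, f - g} : Set ((Fin m → ZMod 3) → ZMod 3)),
      F ≠ 0 ∧ F 0 = 0 ∧ ∀ w : Fin m → ZMod 3, F ≠ fun x => dotp w x) :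
    Function.Injective (fun urv : ZMod 3 × ZMod 3 × (Fin m → ZMod 3) =>
      fun x : {x : Fin m → ZMod 3 // x ≠ 0} =>
        urv.1 * f x.1 + urv.2.1 * g x.1 + dotp urv.2.2 x.1) ∧
    (Set.range (fun urv : ZMod 3 × ZMod 3 × (Fin m → ZMod 3) =>
      fun x : {x : Fin m → ZMod 3 // x ≠ 0} =>
        urv.1 * f x.1 + urv.2.1 * g x.1 + dotp urv.2.2 x.1)).ncard = 3 ^ (m + 2) := by
  have hinj : Function.Injective (fun urv : ZMod 3 × ZMod 3 × (Fin m → ZMod 3) =>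
      fun x : {x : Fin m → ZMod 3 // x ≠ 0} =>
        urv.1 * f x.1 + urv.2.1 * g x.1 + dotp urv.2.2 x.1) := by
    rintro ⟨u, r, v⟩ ⟨u', r', v'⟩ heq
    have h : ∀ x, (u - u') * f x + (r - r') * g x + dotp (v - v') x = 0 := by
      intro x
      by_cases hx : x = 0
      · rw [hx, (hF f (by simp)).2.1, (hF g (by simp)).2.1, dotp_zero_right]
        ring
      · have hxeq := congrFun heq ⟨x, hx⟩
        dsimp only at hxeq
        rw [dotp_sub]
        linear_combination hxeq
    obtain ⟨hu, hr, hv⟩ := eq_zero_of_combination_eq_zero (fun F hmem => (hF F hmem).2.2) h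
    rw [sub_eq_zero.mp hu, sub_eq_zero.mp hr, sub_eq_zero.mp hv]
  refine ⟨hinj, ?_⟩
  rw [← Set.image_univ, Set.ncard_image_of_injective _ hinj, Set.ncard_univ]
  simp only [Nat.card_prod, Nat.card_fun, Nat.card_zmod, Nat.card_fin]
  ring
end

section
/- Let m, k₁, k₂ be integers with m ≥ 9 and 2 ≤ k₁ < k₁ + 1 < k₂ ≤ ⌊(m−1)/2⌋, and let f be the characteristic-type function defined from the weight classes A, C, D. Then Re(f̂(0)) = 3^m − (3/2)·(Σ_{j=1}^{k₂} 2^j·C(m,j) − 2^{k₁}·C(m,k₁)), and for every w ∈ F₃^m with Hamming weight wt(w) = i ≥ 1, Re(f̂(w)) = −(3/2)·(Ψ_{k₂}(i,m) + Ψ_{k₁−1}(i,m) − Ψ_{k₁}(i,m) − 1). -/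
open Finset

open Polynomial in
lemma coeff_one_add_C_mul_X_pow {R : Type*} [CommSemiring R] (r : R) (n t : ℕ) :
    ((1 + C r * X : R[X]) ^ n).coeff t = r ^ t * (n.choose t : R) := by
  have h : (1 + C r * X : R[X]) ^ n = ((1 + X : R[X]) ^ n).comp (C r * X) := by simp
  rw [h, comp_C_mul_X_coeff, coeff_one_add_X_pow, mul_comm]

lemma zeta3_isPrimitiveRoot : IsPrimitiveRoot zeta3 3 := by
  simpa [zeta3] using Complex.isPrimitiveRoot_exp 3 (by norm_num)

lemma one_add_zeta3_add_sq : 1 + zeta3 + zeta3 ^ 2 = 0 := by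
  simpa [Finset.sum_range_succ] using
    zeta3_isPrimitiveRoot.geom_sum_eq_zero (by norm_num)

lemma zeta3_re : zeta3.re = -1 / 2 := by
  have h : zeta3 = Complex.exp ((2 * Real.pi / 3 : ℝ) * Complex.I) := by
    rw [zeta3]
    push_cast
    ring_nf
  rw [h, Complex.exp_ofReal_mul_I_re,
    show 2 * Real.pi / 3 = Real.pi - Real.pi / 3 by ring, Real.cos_pi_sub,
    Real.cos_pi_div_three]
  norm_num

lemma chi_eq_zmodChar (a : ZMod 3) :
    chi a = AddChar.zmodChar 3 zeta3_isPrimitiveRoot.pow_eq_one a :=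
  rfl

lemma chi_add (a b : ZMod 3) : chi (a + b) = chi a * chi b := by
  simp only [chi_eq_zmodChar, AddChar.map_add_eq_mul]

lemma chi_neg_dotp {m : ℕ} (w x : Fin m → ZMod 3) :
    chi (-dotp w x) = ∏ i, chi (-(w i * x i)) := by
  rw [dotp, ← Finset.sum_neg_distrib]
  exact map_prod (AddChar.zmodChar 3 zeta3_isPrimitiveRoot.pow_eq_one).toMonoidHom
    (fun i => Multiplicative.ofAdd (-(w i * x i))) univ

open Polynomial in
lemma sum_chi_neg_mul (b : ZMod 3) :
    ∑ a : ZMod 3, C (chi (-(b * a))) * (X : ℂ[X]) ^ (if a ≠ 0 then 1 else 0) =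
      if b ≠ 0 then 1 + C (-1) * X else 1 + C 2 * X := by
  have h : zeta3 ^ 2 = -1 - zeta3 := by linear_combination one_add_zeta3_add_sq
  have h0 : chi 0 = 1 := by simp [chi]
  have h1 : chi 1 = zeta3 := by simp [chi, ZMod.val_one]
  have h2 : chi 2 = -1 - zeta3 := by rw [← h]; rfl
  have hsum (F : ZMod 3 → ℂ[X]) : ∑ a, F a = F 0 + F 1 + F 2 := Fin.sum_univ_three F
  have e1 : (1 : ZMod 3) ≠ 0 := by decide
  have e2 : (2 : ZMod 3) ≠ 0 := by decide
  have hb : b = 0 ∨ b = 1 ∨ b = 2 := by revert b; decide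
  have n1 : (-1 : ZMod 3) = 2 := by decide
  have n2 : (-2 : ZMod 3) = 1 := by decide
  have n4 : (-(2 * 2) : ZMod 3) = 2 := by decide
  rw [hsum]
  rcases hb with rfl | rfl | rfl
  · simp [h0, e1, e2]
    rw [show (C 2 : ℂ[X]) = 2 from rfl]
    ring
  · simp [h0, h1, h2, e1, e2, n1, n2]
    ring
  · simp [h0, h1, h2, e1, e2, n2, n4]
    ring

open Polynomial in
/-- The weight enumerator of `F₃^m` twisted by the character `x ↦ ζ₃^(-w·x)`. -/
lemma sum_chi_neg_dotp_mul_X_pow {m : ℕ} (w : Fin m → ZMod 3) :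
    ∑ x : Fin m → ZMod 3, C (chi (-dotp w x)) * (X : ℂ[X]) ^ hammingNorm x =
      (1 + C (-1) * X) ^ hammingNorm w * (1 + C 2 * X) ^ (m - hammingNorm w) := by
  have hc : #{i | ¬ w i ≠ 0} = m - hammingNorm w := by
    have := Finset.card_filter_add_card_filter_not (s := univ) (fun i => w i ≠ 0)
    simp only [Finset.card_univ, Fintype.card_fin] at this
    rw [hammingNorm]
    omega
  have hx (x : Fin m → ZMod 3) : C (chi (-dotp w x)) * (X : ℂ[X]) ^ hammingNorm x =
      ∏ i, C (chi (-(w i * x i))) * (X : ℂ[X]) ^ (if x i ≠ 0 then 1 else 0) := by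
    rw [Finset.prod_mul_distrib, Finset.prod_pow_eq_pow_sum, ← Finset.card_filter,
      chi_neg_dotp, map_prod, hammingNorm]
  simp_rw [hx]
  rw [← Fintype.prod_sum fun i (a : ZMod 3) =>
    C (chi (-(w i * a))) * (X : ℂ[X]) ^ (if a ≠ 0 then 1 else 0)]
  simp_rw [sum_chi_neg_mul]
  rw [Finset.prod_ite, Finset.prod_const, Finset.prod_const, hc, hammingNorm]

open Polynomial in
lemma sum_chi_neg_dotp_hammingNorm_eq {m : ℕ} (w : Fin m → ZMod 3) (t : ℕ) :
    ∑ x : Fin m → ZMod 3 with hammingNorm x = t, chi (-dotp w x) =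
      (Kraw t (hammingNorm w) m : ℂ) := by
  have h := congrArg (fun p => p.coeff t) (sum_chi_neg_dotp_mul_X_pow w)
  simp only [finsetSum_coeff, coeff_C_mul, coeff_X_pow, mul_ite, mul_one, mul_zero,
    eq_comm (a := t)] at h
  simp only [coeff_mul, coeff_one_add_C_mul_X_pow,
    Finset.Nat.sum_antidiagonal_eq_sum_range_succ_mk] at h
  rw [Finset.sum_filter, h, Kraw]
  push_cast
  exact Finset.sum_congr rfl fun j _ => by ring

open Polynomial in
lemma sum_chi_neg_dotp {m : ℕ} (w : Fin m → ZMod 3) :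
    ∑ x : Fin m → ZMod 3, chi (-dotp w x) = if w = 0 then 3 ^ m else 0 := by
  have h := congrArg (eval 1) (sum_chi_neg_dotp_mul_X_pow w)
  simp only [eval_finsetSum, eval_mul, eval_C, eval_pow, eval_X, one_pow, mul_one, eval_add,
    eval_one] at h
  rw [h]
  split_ifs with hw
  · subst hw
    norm_num
  · simp [hw]

lemma Kraw_zero_left (x m : ℕ) : Kraw 0 x m = 1 := by
  simp [Kraw]

lemma Kraw_zero_middle (t m : ℕ) : Kraw t 0 m = 2 ^ t * (m.choose t : ℤ) := by
  rw [Kraw, Finset.sum_range_succ']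
  simp

lemma Lloyd_eq_one_add_sum_Icc (k x m : ℕ) :
    Lloyd k x m = 1 + ∑ t ∈ Finset.Icc 1 k, Kraw t x m := by
  rw [Lloyd, Finset.range_eq_Ico, Finset.sum_eq_sum_Ico_succ_bot (by omega), Kraw_zero_left]
  rfl

lemma walsh_ffun_re {m k₁ k₂ : ℕ} (hk₁ : 1 ≤ k₁) (hk : k₁ ≤ k₂) (w : Fin m → ZMod 3) :
    (walsh (ffun m k₁ k₂) w).re =
      (if w = 0 then 3 ^ m else 0) -
        3 / 2 * ((∑ t ∈ Finset.Icc 1 k₂, (Kraw t (hammingNorm w) m : ℝ)) -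
          Kraw k₁ (hammingNorm w) m) := by
  have hterm (x : Fin m → ZMod 3) : chi (ffun m k₁ k₂ x - dotp w x) =
      chi (-dotp w x) + (zeta3 - 1) *
        ∑ t ∈ (Finset.Icc 1 k₂).erase k₁, if hammingNorm x = t then chi (-dotp w x) else 0 := by
    rw [sub_eq_add_neg, chi_add, Finset.sum_ite_eq, ffun]
    simp only [Finset.mem_erase, Finset.mem_Icc]
    by_cases hx : 1 ≤ hammingNorm x ∧ hammingNorm x ≤ k₂ ∧ hammingNorm x ≠ k₁
    · rw [if_pos hx, if_pos ⟨hx.2.2, hx.1, hx.2.1⟩, chi, ZMod.val_one]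
      ring
    · rw [if_neg hx, if_neg fun h => hx ⟨h.2.1, h.2.2, h.1⟩]
      simp [chi]
  have hw : walsh (ffun m k₁ k₂) w =
      ((if w = 0 then 3 ^ m else 0 : ℝ) : ℂ) + (zeta3 - 1) *
        ((∑ t ∈ (Finset.Icc 1 k₂).erase k₁, (Kraw t (hammingNorm w) m : ℝ) : ℝ) : ℂ) := by
    simp_rw [walsh, hterm]
    rw [Finset.sum_add_distrib, ← Finset.mul_sum, Finset.sum_comm, sum_chi_neg_dotp]
    simp_rw [← Finset.sum_filter, sum_chi_neg_dotp_hammingNorm_eq]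
    split_ifs <;> push_cast <;> rfl
  rw [hw, Complex.add_re, Complex.re_mul_ofReal, Complex.ofReal_re, Complex.sub_re,
    Complex.one_re, zeta3_re, Finset.sum_erase_eq_sub (Finset.mem_Icc.2 ⟨hk₁, hk⟩)]
  ring

theorem stmt3 (m k₁ k₂ : ℕ) (hm : 9 ≤ m) (hk₁ : 2 ≤ k₁) (hk : k₁ + 1 < k₂)
    (hk₂ : k₂ ≤ (m - 1) / 2) :
    (walsh (ffun m k₁ k₂) (0 : Fin m → ZMod 3)).re
      = 3 ^ m - 3 / 2 * ((∑ j ∈ Finset.Icc 1 k₂, (2 : ℝ) ^ j * (m.choose j : ℝ))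
          - 2 ^ k₁ * (m.choose k₁ : ℝ)) ∧
    ∀ (w : Fin m → ZMod 3) (i : ℕ), hammingNorm w = i → 1 ≤ i →
      (walsh (ffun m k₁ k₂) w).re
        = -(3 / 2) * ((Lloyd k₂ i m : ℝ) + (Lloyd (k₁ - 1) i m : ℝ)
            - (Lloyd k₁ i m : ℝ) - 1) := by
  obtain ⟨n, rfl⟩ : ∃ n, k₁ = n + 1 := ⟨k₁ - 1, by omega⟩
  constructor
  · rw [walsh_ffun_re (by omega) (by omega), if_pos rfl, hammingNorm_zero]
    simp [Kraw_zero_middle]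
  · rintro w i rfl hi
    have hw : w ≠ 0 := hammingNorm_ne_zero_iff.1 (by omega)
    have hL : Lloyd (n + 1) (hammingNorm w) m =
        Lloyd n (hammingNorm w) m + Kraw (n + 1) (hammingNorm w) m :=
      Finset.sum_range_succ _ _
    rw [walsh_ffun_re (by omega) (by omega), if_neg hw, Nat.add_sub_cancel, hL,
      Lloyd_eq_one_add_sum_Icc k₂]
    push_cast
    ring
end

section
/- Let m, k₁, k₂ be integers with m ≥ 9 and 2 ≤ k₁ < k₁ + 1 < k₂ ≤ ⌊(m−1)/2⌋, and let f, g be the characteristic-type functions defined from the weight classes A, B, C, D. Then the minimum nonzero Hamming weight (minimum distance) of the code C_{f,g} equals Σ_{j=1}^{k₂−1} 2^j·C(m,j); that is, every nonzero codeword of C_{f,g} has Hamming weight at least Σ_{j=1}^{k₂−1} 2^j·C(m,j), and some nonzero codeword attains this weight. -/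
open Finset

/-- The number of vectors of `F₃^m` with a given support `s` is `2 ^ #s`. -/
theorem card_filter_support_eq {m : ℕ} (s : Finset (Fin m)) :
    (univ.filter fun x : Fin m → ZMod 3 => univ.filter (fun i => x i ≠ 0) = s).card =
      2 ^ s.card := by
  have h : (univ.filter fun x : Fin m → ZMod 3 => univ.filter (fun i => x i ≠ 0) = s) =
      Fintype.piFinset fun i => if i ∈ s then ({0}ᶜ : Finset (ZMod 3)) else {0} := by
    ext x
    simp only [mem_filter, mem_univ, true_and, Fintype.mem_piFinset, Finset.ext_iff]
    refine forall_congr' fun i => ?_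
    split_ifs with hi <;> simp [hi]
  have h2 : ({0}ᶜ : Finset (ZMod 3)).card = 2 := by decide
  rw [h, Fintype.card_piFinset]
  simp [apply_ite Finset.card, h2]

theorem card_filter_hammingNorm_eq (m j : ℕ) :
    (univ.filter fun x : Fin m → ZMod 3 => hammingNorm x = j).card = 2 ^ j * m.choose j := by
  have h := card_eq_sum_card_fiberwise
    (s := univ.filter fun x : Fin m → ZMod 3 => hammingNorm x = j)
    (t := powersetCard j (univ : Finset (Fin m)))
    (f := fun x => univ.filter fun i => x i ≠ 0)
    (fun x hx => by simpa [mem_powersetCard, hammingNorm] using hx)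
  rw [h, sum_congr rfl (g := fun _ => 2 ^ j)]
  · simp [mul_comm]
  · intro s hs
    rw [mem_powersetCard] at hs
    rw [← hs.2, ← card_filter_support_eq, filter_filter]
    congr 1
    ext x
    simp only [mem_filter, mem_univ, true_and, and_iff_right_iff_imp]
    rintro rfl
    rfl

theorem card_filter_hammingNorm_mem (m : ℕ) (T : Finset ℕ) :
    (univ.filter fun x : Fin m → ZMod 3 => hammingNorm x ∈ T).card =
      ∑ j ∈ T, 2 ^ j * m.choose j := by
  rw [card_eq_sum_card_fiberwise (f := fun x => hammingNorm x) (t := T)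
    (fun x hx => by simpa using hx)]
  refine sum_congr rfl fun j hj => ?_
  rw [← card_filter_hammingNorm_eq, filter_filter]
  congr 1
  ext x
  simp only [mem_filter, mem_univ, true_and, and_iff_right_iff_imp]
  rintro rfl
  exact hj

/-- A sphere of radius less than half the length is larger than the ball it bounds. -/
theorem sum_range_two_pow_mul_choose_le (m k : ℕ) (hk : 2 * k ≤ m) :
    ∑ j ∈ range k, 2 ^ j * m.choose j ≤ 2 ^ k * m.choose k := by
  induction k with
  | zero => simp
  | succ k ih =>
    rw [sum_range_succ]
    have h1 := ih (by omega)
    have h2 : m.choose k ≤ m.choose (k + 1) := Nat.choose_le_succ_of_lt_half_left (by omega)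
    have h3 : 2 ^ k * m.choose k ≤ 2 ^ k * m.choose (k + 1) := Nat.mul_le_mul_left _ h2
    rw [pow_succ]
    linarith

/-- Balls in `F₃^m` of radius less than half the length fill at most a third of the space. -/
theorem three_mul_sum_range_two_pow_mul_choose_le (m k : ℕ) (hk : 2 * k ≤ m + 1) :
    3 * ∑ j ∈ range k, 2 ^ j * m.choose j ≤ 3 ^ m := by
  have htot : ∑ j ∈ range (m + 1), 2 ^ j * m.choose j = 3 ^ m := by
    have h := add_pow 2 1 m
    norm_num at h
    exact h.symm
  have hrefl : 2 * ∑ j ∈ range k, 2 ^ j * m.choose j ≤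
      ∑ j ∈ (range k).image (m - ·), 2 ^ j * m.choose j := by
    rw [sum_image, mul_sum]
    · refine sum_le_sum fun j hj => ?_
      rw [mem_range] at hj
      rw [Nat.choose_symm (by omega), ← mul_assoc, ← pow_succ']
      exact Nat.mul_le_mul_right _ (Nat.pow_le_pow_right (by norm_num) (by omega))
    · intro a ha b hb hab
      simp only [coe_range, Set.mem_Iio] at ha hb
      dsimp only at hab
      omega
  have hdisj : Disjoint (range k) ((range k).image (m - ·)) := by
    rw [disjoint_left]
    intro a ha hb
    simp only [mem_image, mem_range] at ha hb
    obtain ⟨b, hb, rfl⟩ := hb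
    omega
  have hsub : range k ∪ (range k).image (m - ·) ⊆ range (m + 1) := by
    intro a ha
    simp only [mem_union, mem_image, mem_range] at ha ⊢
    rcases ha with ha | ⟨b, hb, rfl⟩ <;> omega
  have h := sum_le_sum_of_subset (f := fun j => 2 ^ j * m.choose j) hsub
  rw [sum_union hdisj, htot] at h
  linarith

/-- A nonzero linear functional on `F₃^m` is nonzero on two thirds of the space. -/
theorem three_mul_card_filter_dotp_ne_zero {m : ℕ} {v : Fin m → ZMod 3} (hv : v ≠ 0) :
    3 * (univ.filter fun x => dotp v x ≠ 0).card = 2 * 3 ^ m := by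
  let φ : (Fin m → ZMod 3) →+ ZMod 3 :=
    { toFun := dotp v
      map_zero' := by simp [dotp]
      map_add' := fun x y => by simp [dotp, mul_add, sum_add_distrib] }
  have hφ : Function.Surjective φ := by
    obtain ⟨i, hi⟩ := Function.ne_iff.mp hv
    intro a
    refine ⟨Pi.single i ((v i)⁻¹ * a), ?_⟩
    change ∑ j, v j * (Pi.single i ((v i)⁻¹ * a) : Fin m → ZMod 3) j = a
    rw [sum_eq_single i (fun j _ hj => by simp [hj]) (by simp), Pi.single_eq_same,
      mul_inv_cancel_left₀ hi]
  have hfib : (univ : Finset (Fin m → ZMod 3)).card =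
      ∑ a : ZMod 3, (univ.filter fun x => φ x = a).card :=
    card_eq_sum_card_fiberwise (fun _ _ => mem_coe.mpr (mem_univ _))
  rw [sum_congr rfl (g := fun _ => (univ.filter fun x => φ x = 0).card) fun a _ =>
    AddMonoidHom.card_fiber_eq_of_mem_range φ (hφ a) (hφ 0)] at hfib
  have hsplit := card_filter_add_card_filter_not (s := univ) fun x => φ x = 0
  rw [sum_const, smul_eq_mul] at hfib
  simp only [card_univ, Fintype.card_fun, ZMod.card, Fintype.card_fin] at hfib hsplit
  change 3 * (univ.filter fun x => ¬ φ x = 0).card = 2 * 3 ^ m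
  omega

theorem cwt_eq_card_filter (m k₁ k₂ : ℕ) (u r : ZMod 3) (v : Fin m → ZMod 3) :
    cwt m k₁ k₂ u r v = (univ.filter fun x : Fin m → ZMod 3 =>
      x ≠ 0 ∧ u * ffun m k₁ k₂ x + r * gfun m k₁ k₂ x + dotp v x ≠ 0).card := by
  rw [cwt, ← card_image_of_injective _ Subtype.val_injective]
  congr 1
  ext x
  rw [mem_image, mem_filter]
  constructor
  · rintro ⟨y, hy, rfl⟩
    exact ⟨mem_univ _, y.2, (mem_filter.mp hy).2⟩
  · rintro ⟨-, hx, hc⟩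
    exact ⟨⟨x, hx⟩, mem_filter.mpr ⟨mem_univ _, hc⟩, rfl⟩

theorem cwt_ne_zero_iff (m k₁ k₂ : ℕ) (u r : ZMod 3) (v : Fin m → ZMod 3) :
    cwt m k₁ k₂ u r v ≠ 0 ↔ cw m k₁ k₂ u r v ≠ 0 := by
  rw [cwt, card_ne_zero, filter_nonempty_iff, Function.ne_iff]
  exact exists_congr fun x => and_iff_right (mem_univ x)

theorem cwt_self_zero {m k₁ k₂ : ℕ} (hk₁ : 1 ≤ k₁) (hk : k₁ < k₂) {u : ZMod 3} (hu : u ≠ 0) :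
    cwt m k₁ k₂ u u 0 = ∑ j ∈ Icc 1 (k₂ - 1), 2 ^ j * m.choose j := by
  rw [cwt_eq_card_filter, ← card_filter_hammingNorm_mem]
  congr 1
  ext x
  have h2 : (1 + 1 : ZMod 3) ≠ 0 := by decide
  rw [mem_filter, mem_filter, ← hammingNorm_pos_iff]
  simp only [mem_univ, true_and, mem_Icc, ← mul_add, dotp, Pi.zero_apply, zero_mul,
    sum_const_zero, add_zero, mul_ne_zero_iff, ne_eq, hu, not_false_eq_true]
  unfold ffun gfun
  split_ifs <;> simp only [h2, add_zero, zero_add, add_neg_cancel, one_ne_zero, not_true_eq_false,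
    not_false_eq_true, and_true, and_false] <;> grind

/-- If `u ≠ r`, the codeword `c(u,r,0)` is nonzero on the whole sphere of radius `k₂`. -/
theorem le_cwt_zero_of_ne {m k₁ k₂ : ℕ} (hk : k₁ < k₂) {u r : ZMod 3} (hur : u ≠ r) :
    2 ^ k₂ * m.choose k₂ ≤ cwt m k₁ k₂ u r 0 := by
  rw [cwt_eq_card_filter, ← card_filter_hammingNorm_eq]
  refine card_le_card fun x hx => ?_
  simp only [mem_filter, mem_univ, true_and] at hx ⊢
  have hf : ffun m k₁ k₂ x = 1 := if_pos (by omega)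
  have hg : gfun m k₁ k₂ x = -1 := by
    rw [gfun, if_neg (by omega), if_pos hx]
  refine ⟨hammingNorm_pos_iff.mp (by omega), ?_⟩
  simpa [hf, hg, dotp, ← sub_eq_add_neg, sub_eq_zero] using hur

theorem card_dotp_ne_zero_le_cwt_add {m k₁ k₂ : ℕ} (hk₁ : 1 ≤ k₁) (u r : ZMod 3)
    (v : Fin m → ZMod 3) :
    (univ.filter fun x => dotp v x ≠ 0).card ≤
      cwt m k₁ k₂ u r v + ∑ j ∈ range (k₂ + 1), 2 ^ j * m.choose j := by
  rw [cwt_eq_card_filter, ← card_filter_hammingNorm_mem]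
  refine (card_le_card fun x hx => ?_).trans (card_union_le _ _)
  simp only [mem_union, mem_filter, mem_univ, true_and, mem_range] at hx ⊢
  by_cases hw : hammingNorm x < k₂ + 1
  · exact Or.inr hw
  · have hf : ffun m k₁ k₂ x = 0 := if_neg (by omega)
    have hg : gfun m k₁ k₂ x = 0 := by
      rw [gfun, if_neg (by omega), if_neg (by omega)]
    refine Or.inl ⟨hammingNorm_pos_iff.mp (by omega), ?_⟩
    simpa [hf, hg] using hx

theorem stmt7 (m k₁ k₂ : ℕ) (hm : 9 ≤ m) (hk₁ : 2 ≤ k₁) (hk : k₁ + 1 < k₂)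
    (hk₂ : k₂ ≤ (m - 1) / 2) :
    (∀ (u r : ZMod 3) (v : Fin m → ZMod 3), cw m k₁ k₂ u r v ≠ 0 →
      ∑ j ∈ Finset.Icc 1 (k₂ - 1), 2 ^ j * m.choose j ≤ cwt m k₁ k₂ u r v) ∧
    (∃ (u r : ZMod 3) (v : Fin m → ZMod 3), cw m k₁ k₂ u r v ≠ 0 ∧
      cwt m k₁ k₂ u r v = ∑ j ∈ Finset.Icc 1 (k₂ - 1), 2 ^ j * m.choose j) := by
  have hball : ∑ j ∈ Icc 1 (k₂ - 1), 2 ^ j * m.choose j ≤ ∑ j ∈ range k₂, 2 ^ j * m.choose j :=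
    sum_le_sum_of_subset fun j hj => by
      rw [mem_Icc] at hj
      rw [mem_range]
      omega
  refine ⟨fun u r v hc => ?_, 1, 1, 0, ?_, cwt_self_zero (by omega) (by omega) one_ne_zero⟩
  · by_cases hv : v = 0
    · subst hv
      by_cases hur : u = r
      · subst hur
        have hu : u ≠ 0 := by
          rintro rfl
          exact hc (by ext x; simp [cw, dotp])
        exact (cwt_self_zero (by omega) (by omega) hu).ge
      · exact (hball.trans (sum_range_two_pow_mul_choose_le m k₂ (by omega))).trans
          (le_cwt_zero_of_ne (by omega) hur)
    · have h1 := card_dotp_ne_zero_le_cwt_add (k₂ := k₂) (by omega : 1 ≤ k₁) u r v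
      have h2 := three_mul_card_filter_dotp_ne_zero hv
      have h3 := three_mul_sum_range_two_pow_mul_choose_le m (k₂ + 1) (by omega)
      have h4 := sum_range_succ (fun j => 2 ^ j * m.choose j) k₂
      omega
  · rw [← cwt_ne_zero_iff, cwt_self_zero (by omega) (by omega) one_ne_zero]
    refine (sum_pos (fun j hj => ?_) ⟨1, mem_Icc.mpr (by omega)⟩).ne'
    rw [mem_Icc] at hj
    exact Nat.mul_pos (by positivity) (Nat.choose_pos (by omega))
end

section
/- Let m, k be integers with m ≥ 9 and 2 ≤ k ≤ ⌊(m−1)/2⌋. Then 2^k·C(m,k) > Σ_{j=1}^{k−1} 2^j·C(m,j). -/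
open Finset

theorem stmt10 (m k : ℕ) (hm : 9 ≤ m) (hk : 2 ≤ k) (hk' : k ≤ (m - 1) / 2) :
    ∑ j ∈ Finset.Icc 1 (k - 1), 2 ^ j * m.choose j < 2 ^ k * m.choose k := by
  induction k, hk using Nat.le_induction with
  | base =>
    have h : m.choose 1 ≤ m.choose 2 := Nat.choose_le_succ_of_lt_half_left (by omega)
    have h0 : 0 < m.choose 1 := Nat.choose_pos (by omega)
    simp only [Nat.add_one_sub_one, Icc_self, sum_singleton]
    omega
  | succ n hn ih =>
    have h : m.choose n ≤ m.choose (n + 1) := Nat.choose_le_succ_of_lt_half_left (by omega)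
    obtain ⟨p, rfl⟩ : ∃ p, n = p + 1 := ⟨n - 1, by omega⟩
    have ih := ih (by omega)
    simp only [Nat.add_sub_cancel] at ih ⊢
    rw [sum_Icc_succ_top (by omega)]
    calc _ < 2 ^ (p + 1) * m.choose (p + 1) + 2 ^ (p + 1) * m.choose (p + 1) := by gcongr
      _ = 2 ^ (p + 1 + 1) * m.choose (p + 1) := by ring
      _ ≤ _ := by gcongr
end

section
/- Let m, k₁, k₂ be integers with m ≥ 9 and 2 ≤ k₁ < k₁ + 1 < k₂ ≤ ⌊(m−1)/2⌋, and let f, g be the characteristic-type functions defined from the weight classes A, B, C, D. Then for all F₁, F₂ ∈ {f, g, f+g, f−g} with F₁ ≠ F₂ and all v₁, v₂ ∈ F₃^m, one has Re((F₁+F₂)^∧(v₁+v₂)) + Re((F₂−F₁)^∧(v₁−v₂)) − 2·Re(F̂₁(v₁)) + Re(F̂₂(v₂)) ≠ 3^m. -/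
open Finset

/-- `2 Re ζ₃^a` as an integer. -/
def twiceReChi (a : ZMod 3) : ℤ := if a = 0 then 2 else -1

lemma zeta3_eq : zeta3 = Complex.exp ((2 * Real.pi / 3 : ℝ) * Complex.I) := by
  unfold zeta3; congr 1; push_cast; ring

lemma zeta3_im_sq : zeta3.im ^ 2 = 3 / 4 := by
  have h : zeta3.re ^ 2 + zeta3.im ^ 2 = 1 := by
    rw [zeta3_eq, Complex.exp_ofReal_mul_I_re, Complex.exp_ofReal_mul_I_im]
    exact Real.cos_sq_add_sin_sq _
  rw [zeta3_re] at h
  linarith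

lemma chi_re (a : ZMod 3) : (chi a).re = twiceReChi a / 2 := by
  have h := zeta3_im_sq
  have h0 : (chi 0).re = twiceReChi 0 / 2 := by simp [chi, twiceReChi]
  have h1 : (chi 1).re = twiceReChi 1 / 2 := by
    have : (1 : ZMod 3).val = 1 := rfl
    simp [chi, twiceReChi, this, zeta3_re]
  have h2 : (chi 2).re = twiceReChi 2 / 2 := by
    have hv : (2 : ZMod 3).val = 2 := rfl
    have hn : (2 : ZMod 3) ≠ 0 := by decide
    simp only [chi, twiceReChi, hv, hn, if_false, pow_two, Complex.mul_re, zeta3_re]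
    push_cast
    linarith
  fin_cases a
  exacts [h0, h1, h2]

lemma dotp_neg_right {m : ℕ} (w x : Fin m → ZMod 3) : dotp w (-x) = -dotp w x := by
  simp [dotp]

lemma dotp_add_right {m : ℕ} (w x y : Fin m → ZMod 3) :
    dotp w (x + y) = dotp w x + dotp w y := by
  simp [dotp, mul_add, sum_add_distrib]

lemma dotp_add_left {m : ℕ} (w z x : Fin m → ZMod 3) :
    dotp (w + z) x = dotp w x + dotp z x := by
  simp [dotp, add_mul, sum_add_distrib]

lemma dotp_sub_left {m : ℕ} (w z x : Fin m → ZMod 3) :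
    dotp (w - z) x = dotp w x - dotp z x := by
  simp [dotp, sub_mul, sum_sub_distrib]

lemma dotp_zero_left {m : ℕ} (x : Fin m → ZMod 3) : dotp 0 x = 0 := by
  simp [dotp]

lemma dotp_single_right {m : ℕ} (w : Fin m → ZMod 3) (i : Fin m) (c : ZMod 3) :
    dotp w (Pi.single i c) = w i * c := by
  simp [dotp, Pi.single_apply]

lemma twiceReChi_sub_add_twiceReChi_add : ∀ a b : ZMod 3,
    twiceReChi (a - b) + twiceReChi (a + b) = twiceReChi a * twiceReChi b := by
  decide

/-- For an even function the real part of the Walsh transform splits pointwise. -/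
lemma four_mul_walsh_re {m : ℕ} {F : (Fin m → ZMod 3) → ZMod 3} (hF : ∀ x, F (-x) = F x)
    (w : Fin m → ZMod 3) :
    4 * (walsh F w).re = ((∑ x, twiceReChi (F x) * twiceReChi (dotp w x) : ℤ) : ℝ) := by
  have h1 : 2 * (walsh F w).re = ((∑ x, twiceReChi (F x - dotp w x) : ℤ) : ℝ) := by
    simp only [walsh, Complex.re_sum, chi_re, mul_sum, Int.cast_sum]
    exact sum_congr rfl fun x _ => by ring
  have h2 : ∑ x, twiceReChi (F x - dotp w x) = ∑ x, twiceReChi (F x + dotp w x) := by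
    rw [← Equiv.sum_comp (Equiv.neg (Fin m → ZMod 3))]
    simp [hF, dotp_neg_right]
  have h3 : ∑ x, twiceReChi (F x) * twiceReChi (dotp w x)
      = 2 * ∑ x, twiceReChi (F x - dotp w x) := by
    rw [two_mul]
    nth_rw 2 [h2]
    rw [← sum_add_distrib]
    exact sum_congr rfl fun x _ => (twiceReChi_sub_add_twiceReChi_add _ _).symm
  rw [h3]
  push_cast at h1 ⊢
  linarith

lemma sum_twiceReChi_dotp {m : ℕ} (w : Fin m → ZMod 3) :
    ∑ x, twiceReChi (dotp w x) = if w = 0 then 2 * 3 ^ m else 0 := by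
  split_ifs with hw
  · subst hw
    simp [dotp_zero_left, twiceReChi, mul_comm]
  · obtain ⟨i, hi⟩ := Function.ne_iff.1 hw
    have hinv : ∀ a : ZMod 3, a ≠ 0 → a * a = 1 := by decide
    have shift : ∀ c : ZMod 3,
        ∑ x, twiceReChi (dotp w x + c) = ∑ x, twiceReChi (dotp w x) := by
      intro c
      rw [← Equiv.sum_comp (Equiv.addRight (Pi.single i (w i * c) : Fin m → ZMod 3))
        (fun x => twiceReChi (dotp w x))]
      simp [dotp_add_right, dotp_single_right, ← mul_assoc, hinv _ hi]
    have hpt : ∀ a : ZMod 3, twiceReChi a + twiceReChi (a + 1) + twiceReChi (a + 2) = 0 := by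
      decide
    have htot : ∑ x, (twiceReChi (dotp w x) + twiceReChi (dotp w x + 1)
        + twiceReChi (dotp w x + 2)) = 0 := sum_eq_zero fun x _ => hpt _
    rw [sum_add_distrib, sum_add_distrib, shift, shift] at htot
    omega

lemma exists_hammingNorm_eq_dotp_ne_zero {m t : ℕ} (ht : 1 ≤ t) (htm : t ≤ m)
    {v : Fin m → ZMod 3} (hv : v ≠ 0) :
    ∃ x : Fin m → ZMod 3, hammingNorm x = t ∧ dotp v x ≠ 0 := by
  obtain ⟨i, hi⟩ := Function.ne_iff.1 hv
  obtain ⟨s, his, -, hs⟩ := exists_subsuperset_card_eq (subset_univ ({i} : Finset (Fin m)))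
    (by simpa using ht) (by simpa using htm)
  have hi' : i ∈ s := by simpa using his
  let x : Fin m → ZMod 3 := fun j => if j ∈ s then 1 else 0
  have hx : hammingNorm x = t := by simp [hammingNorm, x, hs]
  by_cases h : dotp v x = 0
  · refine ⟨x + Pi.single i 1, ?_, ?_⟩
    · rw [← hx]
      unfold hammingNorm
      congr 1
      ext j
      rcases eq_or_ne j i with rfl | hj
      · simpa [x, hi'] using (by decide : (1 : ZMod 3) + 1 ≠ 0)
      · simp [hj]
    · simpa [dotp_add_right, dotp_single_right, h] using hi
  · exact ⟨x, hx, h⟩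

lemma card_hammingNorm_eq (m k : ℕ) :
    #{x : Fin m → ZMod 3 | hammingNorm x = k} = m.choose k * 2 ^ k := by
  induction m generalizing k with
  | zero =>
    cases k with
    | zero => simp [hammingNorm]
    | succ k => simp [hammingNorm]
  | succ m ih =>
    have hcons : ∀ (a : ZMod 3) (x : Fin m → ZMod 3),
        hammingNorm (Fin.cons a x : Fin (m + 1) → ZMod 3)
          = (if a = 0 then 0 else 1) + hammingNorm x := by
      intro a x
      simp only [hammingNorm, card_filter, Fin.sum_univ_succ, Fin.cons_zero, Fin.cons_succ]
      split_ifs <;> simp_all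
    have hsum : #{x : Fin (m + 1) → ZMod 3 | hammingNorm x = k}
        = ∑ a : ZMod 3, #{x : Fin m → ZMod 3 | (if a = 0 then 0 else 1) + hammingNorm x = k} := by
      simp only [card_filter]
      rw [← Equiv.sum_comp (Fin.consEquiv fun _ : Fin (m + 1) => ZMod 3), Fintype.sum_prod_type]
      refine sum_congr rfl fun a _ => sum_congr rfl fun x _ => ?_
      rw [← hcons]
      rfl
    have huniv : (univ : Finset (ZMod 3)) = {0, 1, 2} := by decide
    have h2 : (2 : ZMod 3) ≠ 0 := by decide
    have h3 : (1 : ZMod 3) ≠ 2 := by decide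
    rw [hsum, huniv, sum_insert (by decide), sum_pair h3]
    simp only [if_true, one_ne_zero, h2, if_false, zero_add, ih]
    cases k with
    | zero => simp
    | succ k =>
      simp only [add_comm 1, Nat.add_right_cancel_iff, ih, Nat.choose_succ_succ]
      ring

/-- The cardinality of a Hamming ball of radius `k` in `F₃^m`. -/
def ballCard (m k : ℕ) : ℕ := ∑ t ∈ range (k + 1), m.choose t * 2 ^ t

lemma card_hammingNorm_le (m k : ℕ) :
    #{x : Fin m → ZMod 3 | hammingNorm x ≤ k} = ballCard m k := by
  rw [ballCard, card_eq_sum_card_fiberwise (f := hammingNorm) (t := range (k + 1))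
    (by intro x hx; simpa [Nat.lt_succ_iff] using hx)]
  refine sum_congr rfl fun t ht => ?_
  rw [← card_hammingNorm_eq, filter_filter]
  congr 1
  ext x
  simp only [mem_filter, mem_univ, true_and]
  rw [mem_range] at ht
  omega

lemma ballCard_succ_right (m k : ℕ) :
    ballCard m (k + 1) = ballCard m k + m.choose (k + 1) * 2 ^ (k + 1) :=
  sum_range_succ _ _

lemma ballCard_succ_succ (m k : ℕ) :
    ballCard (m + 1) (k + 1) = ballCard m (k + 1) + 2 * ballCard m k := by
  induction k with
  | zero => simp [ballCard, sum_range_succ]; ring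
  | succ k ih =>
    rw [ballCard_succ_right, ih, ballCard_succ_right m (k + 1), ballCard_succ_right m k,
      Nat.choose_succ_succ]
    ring

lemma ballCard_mono (m : ℕ) {k l : ℕ} (h : k ≤ l) : ballCard m k ≤ ballCard m l :=
  sum_le_sum_of_subset (range_subset_range.2 (by omega))

lemma ballCard_succ_left_le (m k : ℕ) : ballCard (m + 1) k ≤ 3 * ballCard m k := by
  cases k with
  | zero => simp [ballCard]
  | succ k =>
    have := ballCard_mono m (Nat.le_succ k)
    rw [ballCard_succ_succ]
    simp only [Nat.succ_eq_add_one] at this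
    omega

lemma ballCard_odd_step (n : ℕ) :
    ballCard (2 * n + 5) (n + 2) ≤ 9 * ballCard (2 * n + 3) (n + 1) := by
  have hsymm : (2 * n + 3).choose (n + 2) = (2 * n + 3).choose (n + 1) :=
    Nat.choose_symm_of_eq_add (by omega)
  have h1 : ballCard (2 * n + 5) (n + 2) = _ := ballCard_succ_succ (2 * n + 4) (n + 1)
  have h2 : ballCard (2 * n + 4) (n + 1 + 1) = _ := ballCard_succ_succ (2 * n + 3) (n + 1)
  have h3 : ballCard (2 * n + 4) (n + 1) = _ := ballCard_succ_succ (2 * n + 3) n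
  have h4 := ballCard_succ_right (2 * n + 3) (n + 1)
  have h5 := ballCard_succ_right (2 * n + 3) n
  rw [hsymm, pow_succ _ (n + 1), ← mul_assoc] at h4
  omega

lemma ballCard_odd_lt (n : ℕ) (hn : 4 ≤ n) : 9 * ballCard (2 * n + 1) n < 2 * 3 ^ (2 * n + 1) := by
  induction n, hn using Nat.le_induction with
  | base => decide
  | succ n hn ih =>
    obtain ⟨l, rfl⟩ := Nat.exists_eq_add_of_le' (show 1 ≤ n by omega)
    have : ballCard (2 * l + 3 + 2) (l + 1 + 1) ≤ _ := ballCard_odd_step l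
    rw [show 2 * (l + 1) + 1 = 2 * l + 3 by ring] at ih
    rw [show 2 * (l + 1 + 1) + 1 = 2 * l + 3 + 2 by ring, pow_add]
    omega

lemma ballCard_half_lt {m : ℕ} (hm : 9 ≤ m) : 9 * ballCard m ((m - 1) / 2) < 2 * 3 ^ m := by
  rcases Nat.even_or_odd' m with ⟨n, rfl | rfl⟩
  · obtain ⟨l, rfl⟩ := Nat.exists_eq_add_of_le' (show 1 ≤ n by omega)
    have h1 := ballCard_odd_lt l (by omega)
    have h2 := ballCard_succ_left_le (2 * l + 1) l
    rw [show 2 * (l + 1) = 2 * l + 1 + 1 by ring, show (2 * l + 1 + 1 - 1) / 2 = l by omega,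
      pow_succ]
    omega
  · rw [show (2 * n + 1 - 1) / 2 = n by omega]
    exact ballCard_odd_lt n (by omega)

/-- The pointwise contribution to the Walsh combination, at a point where the functions take the
values `a`, `b` and the linear forms take the values `p`, `q`. -/
def term (a b p q : ZMod 3) : ℤ :=
  twiceReChi (a + b) * twiceReChi (p + q) + twiceReChi (b - a) * twiceReChi (p - q)
    - 2 * (twiceReChi a * twiceReChi p) + twiceReChi b * twiceReChi q

lemma sum_term_zero {m : ℕ} (v₁ v₂ : Fin m → ZMod 3) :
    ∑ x, term 0 0 (dotp v₁ x) (dotp v₂ x)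
      = 4 * 3 ^ m * ((if v₁ + v₂ = 0 then 1 else 0) + (if v₁ - v₂ = 0 then 1 else 0)
        - 2 * (if v₁ = 0 then 1 else 0) + (if v₂ = 0 then 1 else 0)) := by
  have h0 : twiceReChi 0 = 2 := rfl
  simp only [term, add_zero, sub_zero, h0, sum_add_distrib, sum_sub_distrib, ← mul_sum,
    ← dotp_add_left, ← dotp_sub_left, sum_twiceReChi_dotp]
  split_ifs <;> ring

lemma term_le : ∀ a b p q : ZMod 3,
    term a b p q ≤ term 0 0 p q + if a = 0 ∧ b = 0 then 0 else 18 := by decide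

lemma term_zero_right_le : ∀ a b p : ZMod 3, term a b p 0 ≤ term 0 0 p 0 := by decide

lemma term_diag_le : ∀ a b p : ZMod 3, term a b p p ≤ term 0 0 p p := by decide

lemma term_antidiag_le : ∀ a b p : ZMod 3, term a b p (-p) ≤ term 0 0 p (-p) := by decide

lemma term_zero_right_lt : ∀ a b p : ZMod 3, a ≠ 0 → a + b = 0 → p ≠ 0 →
    term a b p 0 < term 0 0 p 0 := by decide

lemma term_diag_lt : ∀ a b p : ZMod 3, a ≠ 0 → b = 0 → p ≠ 0 →
    term a b p p < term 0 0 p p := by decide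

lemma term_antidiag_lt : ∀ a b p : ZMod 3, a ≠ 0 → b = 0 → p ≠ 0 →
    term a b p (-p) < term 0 0 p (-p) := by decide

lemma term_zero_zero_lt : ∀ a b : ZMod 3, b ≠ 0 → a = 0 →
    term a b 0 0 < term 0 0 0 0 := by decide

lemma sum_term_ne {m k : ℕ} {F₁ F₂ : (Fin m → ZMod 3) → ZMod 3} (hm : 0 < m)
    (hk : 9 * ballCard m k < 2 * 3 ^ m)
    (hsupp : ∀ x, k < hammingNorm x → F₁ x = 0 ∧ F₂ x = 0)
    (h₁ : ∃ t, 1 ≤ t ∧ t ≤ m ∧ ∀ x, hammingNorm x = t → F₁ x ≠ 0 ∧ F₂ x = 0)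
    (h₂ : ∃ t, 1 ≤ t ∧ t ≤ m ∧ ∀ x, hammingNorm x = t → F₂ x ≠ 0 ∧ F₁ x = 0)
    (h₁₂ : ∃ t, 1 ≤ t ∧ t ≤ m ∧ ∀ x, hammingNorm x = t → F₁ x ≠ 0 ∧ F₁ x + F₂ x = 0)
    (v₁ v₂ : Fin m → ZMod 3) :
    ∑ x, term (F₁ x) (F₂ x) (dotp v₁ x) (dotp v₂ x) ≠ 4 * 3 ^ m := by
  have hpos : (0 : ℤ) < 3 ^ m := by positivity
  have hbase := sum_term_zero v₁ v₂
  have htwo : ∀ v : Fin m → ZMod 3, v + v = 0 → v = 0 := by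
    intro v h
    funext i
    exact (by decide : ∀ a : ZMod 3, a + a = 0 → a = 0) _ (congrFun h i)
  rcases eq_or_ne v₂ 0 with rfl | hv₂
  · rcases eq_or_ne v₁ 0 with rfl | hv₁
    · obtain ⟨t, ht, htm, h⟩ := h₂
      have h1 : (fun _ => 1 : Fin m → ZMod 3) ≠ 0 :=
        Function.ne_iff.2 ⟨⟨0, hm⟩, by simp⟩
      obtain ⟨x, hx, -⟩ := exists_hammingNorm_eq_dotp_ne_zero ht htm h1
      simp only [dotp_zero_left] at hbase ⊢
      have hlt := sum_lt_sum (fun x (_ : x ∈ univ) => term_zero_right_le (F₁ x) (F₂ x) 0)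
        ⟨x, mem_univ x, term_zero_zero_lt _ _ (h x hx).1 (h x hx).2⟩
      norm_num at hbase
      simp only [sum_const, card_univ] at hlt
      norm_num at hlt
      omega
    · obtain ⟨t, ht, htm, h⟩ := h₁₂
      obtain ⟨x, hx, hp⟩ := exists_hammingNorm_eq_dotp_ne_zero ht htm hv₁
      simp only [dotp_zero_left] at hbase ⊢
      have hlt := sum_lt_sum
        (fun x (_ : x ∈ univ) => term_zero_right_le (F₁ x) (F₂ x) (dotp v₁ x))
        ⟨x, mem_univ x, term_zero_right_lt _ _ _ (h x hx).1 (h x hx).2 hp⟩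
      simp only [add_zero, sub_zero, hv₁, if_false, if_true] at hbase
      omega
  rcases eq_or_ne v₁ v₂ with rfl | hsub
  · obtain ⟨t, ht, htm, h⟩ := h₁
    obtain ⟨x, hx, hp⟩ := exists_hammingNorm_eq_dotp_ne_zero ht htm hv₂
    have hlt := sum_lt_sum (fun x (_ : x ∈ univ) => term_diag_le (F₁ x) (F₂ x) (dotp v₁ x))
      ⟨x, mem_univ x, term_diag_lt _ _ _ (h x hx).1 (h x hx).2 hp⟩
    simp only [mt (htwo v₁) hv₂, sub_self, hv₂, if_false, if_true] at hbase
    omega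
  rcases eq_or_ne (v₁ + v₂) 0 with hadd | hadd
  · obtain rfl : v₂ = -v₁ := eq_neg_of_add_eq_zero_right hadd
    have hv₁ : v₁ ≠ 0 := by simpa using hv₂
    obtain ⟨t, ht, htm, h⟩ := h₁
    obtain ⟨x, hx, hp⟩ := exists_hammingNorm_eq_dotp_ne_zero ht htm hv₁
    have hneg : ∀ x, dotp (-v₁) x = -dotp v₁ x := fun x => by simp [dotp]
    simp only [hneg] at hbase ⊢
    have hlt := sum_lt_sum
      (fun x (_ : x ∈ univ) => term_antidiag_le (F₁ x) (F₂ x) (dotp v₁ x))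
      ⟨x, mem_univ x, term_antidiag_lt _ _ _ (h x hx).1 (h x hx).2 hp⟩
    simp only [hadd, sub_eq_zero, hsub, hv₁, hv₂, if_false, if_true] at hbase
    omega
  · have hle : ∑ x, term (F₁ x) (F₂ x) (dotp v₁ x) (dotp v₂ x)
        ≤ ∑ x, term 0 0 (dotp v₁ x) (dotp v₂ x) + 18 * ballCard m k := by
      have hsum : ∑ x : Fin m → ZMod 3, (if hammingNorm x ≤ k then (18 : ℤ) else 0)
          = 18 * ballCard m k := by
        rw [← card_hammingNorm_le, ← sum_filter, sum_const, nsmul_eq_mul, mul_comm]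
      rw [← hsum, ← sum_add_distrib]
      refine sum_le_sum fun x _ => (term_le _ _ _ _).trans ?_
      split_ifs with hF hx hx
      · omega
      · omega
      · exact le_rfl
      · exact absurd (hsupp x (not_le.1 hx)) hF
    have hk' : 9 * (ballCard m k : ℤ) < 2 * 3 ^ m := by exact_mod_cast hk
    simp only [hadd, sub_eq_zero, hsub, hv₂, if_false] at hbase
    split_ifs at hbase <;> omega

theorem stmt13 (m k₁ k₂ : ℕ) (hm : 9 ≤ m) (hk₁ : 2 ≤ k₁) (hk : k₁ + 1 < k₂)
    (hk₂ : k₂ ≤ (m - 1) / 2) :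
    ∀ F₁ ∈ ({ffun m k₁ k₂, gfun m k₁ k₂, ffun m k₁ k₂ + gfun m k₁ k₂,
        ffun m k₁ k₂ - gfun m k₁ k₂} : Set ((Fin m → ZMod 3) → ZMod 3)),
      ∀ F₂ ∈ ({ffun m k₁ k₂, gfun m k₁ k₂, ffun m k₁ k₂ + gfun m k₁ k₂,
        ffun m k₁ k₂ - gfun m k₁ k₂} : Set ((Fin m → ZMod 3) → ZMod 3)),
        F₁ ≠ F₂ → ∀ v₁ v₂ : Fin m → ZMod 3,
          (walsh (F₁ + F₂) (v₁ + v₂)).re + (walsh (F₂ - F₁) (v₁ - v₂)).re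
            - 2 * (walsh F₁ v₁).re + (walsh F₂ v₂).re ≠ 3 ^ m := by
  have hA : ∀ x : Fin m → ZMod 3, hammingNorm x = 1 →
      ffun m k₁ k₂ x = 1 ∧ gfun m k₁ k₂ x = 0 := by
    intro x hx
    constructor
    · rw [ffun, if_pos (by omega)]
    · rw [gfun, if_neg (by omega), if_neg (by omega)]
  have hB : ∀ x : Fin m → ZMod 3, hammingNorm x = k₁ →
      ffun m k₁ k₂ x = 0 ∧ gfun m k₁ k₂ x = 1 := by
    intro x hx
    constructor
    · rw [ffun, if_neg (by omega)]
    · rw [gfun, if_pos (by omega)]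
  have hC : ∀ x : Fin m → ZMod 3, hammingNorm x = k₁ + 1 →
      ffun m k₁ k₂ x = 1 ∧ gfun m k₁ k₂ x = 1 := by
    intro x hx
    constructor
    · rw [ffun, if_pos (by omega)]
    · rw [gfun, if_pos (by omega)]
  have hD : ∀ x : Fin m → ZMod 3, hammingNorm x = k₂ →
      ffun m k₁ k₂ x = 1 ∧ gfun m k₁ k₂ x = -1 := by
    intro x hx
    constructor
    · rw [ffun, if_pos (by omega)]
    · rw [gfun, if_neg (by omega), if_pos (by omega)]
  have hO : ∀ x : Fin m → ZMod 3, k₂ < hammingNorm x →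
      ffun m k₁ k₂ x = 0 ∧ gfun m k₁ k₂ x = 0 := by
    intro x hx
    constructor
    · rw [ffun, if_neg (by omega)]
    · rw [gfun, if_neg (by omega), if_neg (by omega)]
  have hneg : ∀ x : Fin m → ZMod 3, hammingNorm (-x) = hammingNorm x := fun x => by
    simp [hammingNorm]
  set S : Set ((Fin m → ZMod 3) → ZMod 3) := {ffun m k₁ k₂, gfun m k₁ k₂,
    ffun m k₁ k₂ + gfun m k₁ k₂, ffun m k₁ k₂ - gfun m k₁ k₂}
  have heven : ∀ F ∈ S, ∀ x, F (-x) = F x := by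
    rintro F (rfl | rfl | rfl | rfl) x <;> simp [ffun, gfun, hneg]
  have hzero : ∀ F ∈ S, ∀ x, k₂ < hammingNorm x → F x = 0 := by
    rintro F (rfl | rfl | rfl | rfl) x hx <;> simp [hO x hx]
  have hdiff : ∀ F₁ ∈ S, ∀ F₂ ∈ S, F₁ ≠ F₂ →
      (∃ t, 1 ≤ t ∧ t ≤ m ∧ ∀ x, hammingNorm x = t → F₁ x ≠ 0 ∧ F₂ x = 0) ∧
      ∃ t, 1 ≤ t ∧ t ≤ m ∧ ∀ x, hammingNorm x = t → F₁ x ≠ 0 ∧ F₁ x + F₂ x = 0 := by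
    rintro F₁ (rfl | rfl | rfl | rfl) F₂ (rfl | rfl | rfl | rfl) hne <;>
    first
    | exact absurd rfl hne
    | refine ⟨?_, ?_⟩ <;>
      first
      | exact ⟨1, by omega, by omega, fun x hx => by
          simp only [Pi.add_apply, Pi.sub_apply, hA x hx]; decide⟩
      | exact ⟨k₁, by omega, by omega, fun x hx => by
          simp only [Pi.add_apply, Pi.sub_apply, hB x hx]; decide⟩
      | exact ⟨k₁ + 1, by omega, by omega, fun x hx => by
          simp only [Pi.add_apply, Pi.sub_apply, hC x hx]; decide⟩
      | exact ⟨k₂, by omega, by omega, fun x hx => by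
          simp only [Pi.add_apply, Pi.sub_apply, hD x hx]; decide⟩
  intro F₁ hF₁ F₂ hF₂ hne v₁ v₂ heq
  have he₁ := heven F₁ hF₁
  have he₂ := heven F₂ hF₂
  have hball : 9 * ballCard m k₂ < 2 * 3 ^ m :=
    (Nat.mul_le_mul_left 9 (ballCard_mono m hk₂)).trans_lt (ballCard_half_lt hm)
  have hd := hdiff F₁ hF₁ F₂ hF₂ hne
  refine sum_term_ne (by omega) hball (fun x hx => ⟨hzero F₁ hF₁ x hx, hzero F₂ hF₂ x hx⟩)
    hd.1 (hdiff F₂ hF₂ F₁ hF₁ hne.symm).1 hd.2 v₁ v₂ ?_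
  have w1 := four_mul_walsh_re (F := F₁ + F₂) (fun x => by simp [he₁, he₂]) (v₁ + v₂)
  have w2 := four_mul_walsh_re (F := F₂ - F₁) (fun x => by simp [he₁, he₂]) (v₁ - v₂)
  have w3 := four_mul_walsh_re he₁ v₁
  have w4 := four_mul_walsh_re he₂ v₂
  simp only [dotp_add_left, dotp_sub_left, Pi.add_apply, Pi.sub_apply] at w1 w2
  have hreal : ((∑ x, term (F₁ x) (F₂ x) (dotp v₁ x) (dotp v₂ x) : ℤ) : ℝ) = 4 * 3 ^ m := by
    simp only [term, sum_add_distrib, sum_sub_distrib, ← mul_sum]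
    push_cast at w1 w2 w3 w4 ⊢
    linarith
  exact_mod_cast hreal
end
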